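/- Let d ≥ 2 be an integer, α ∈ (0,2), and r ∈ (0,1). Then ∫_0^r s^{α-1} I(s^2; d/2-α/2, α/2) ds = (r^α/α) I(r^2; d/2-α/2, α/2) - (1/α) · (B(d/2, α/2)/B(d/2-α/2, α/2)) · I(r^2; d/2, α/2). -/

import Mathlib

open Real MeasureTheory

/-- Beta function B(z,w) = Γ(z)Γ(w)/Γ(z+w). -/
noncomputable def betaFn (z w : ℝ) : ℝ :=
  Real.Gamma z * Real.Gamma w / Real.Gamma (z + w)

/-- Regularized incomplete Beta function I(x; z, w). -/
noncomputable def regIncBeta (x z w : ℝ) : ℝ :=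
  (∫ u in (0:ℝ)..x, u ^ (z - 1) * (1 - u) ^ (w - 1)) / betaFn z w

lemma intervalIntegrable_rpow_mul_one_sub_rpow {z x : ℝ} (hz : 0 < z) (hx : x ∈ Set.Ico (0:ℝ) 1)
    (w : ℝ) :
    IntervalIntegrable (fun u : ℝ => u ^ (z - 1) * (1 - u) ^ (w - 1)) volume 0 x := by
  refine (intervalIntegral.intervalIntegrable_rpow' (r := z - 1) (by linarith)).mul_continuousOn ?_
  refine ContinuousOn.rpow_const (by fun_prop) fun u hu => Or.inl ?_
  rw [Set.uIcc_of_le hx.1] at hu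
  linarith [hu.2, hx.2]

lemma continuousOn_integral_rpow_mul_one_sub_rpow {z x : ℝ} (hz : 0 < z)
    (hx : x ∈ Set.Ico (0:ℝ) 1) (w : ℝ) :
    ContinuousOn (fun y : ℝ => ∫ u in (0:ℝ)..y, u ^ (z - 1) * (1 - u) ^ (w - 1))
      (Set.Icc 0 x) := by
  have h := intervalIntegrable_rpow_mul_one_sub_rpow hz hx w
  rw [← Set.uIcc_of_le hx.1]
  exact intervalIntegral.continuousOn_primitive_interval
    ((intervalIntegrable_iff').1 h)

lemma hasDerivAt_integral_rpow_mul_one_sub_rpow {z x : ℝ} (hz : 0 < z)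
    (hx : x ∈ Set.Ioo (0:ℝ) 1) (w : ℝ) :
    HasDerivAt (fun y : ℝ => ∫ u in (0:ℝ)..y, u ^ (z - 1) * (1 - u) ^ (w - 1))
      (x ^ (z - 1) * (1 - x) ^ (w - 1)) x := by
  have hc : ContinuousOn (fun u : ℝ => u ^ (z - 1) * (1 - u) ^ (w - 1)) (Set.Ioo 0 1) := by
    refine ContinuousOn.mul ?_ ?_
    · exact continuousOn_id.rpow_const fun u hu => Or.inl hu.1.ne'
    · exact ContinuousOn.rpow_const (by fun_prop) fun u hu => Or.inl (by linarith [hu.2])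
  exact intervalIntegral.integral_hasDerivAt_right
    (intervalIntegrable_rpow_mul_one_sub_rpow hz ⟨hx.1.le, hx.2⟩ w)
    (hc.stronglyMeasurableAtFilter isOpen_Ioo x hx)
    (hc.continuousAt (isOpen_Ioo.mem_nhds hx))

/-- Integration by parts for the unnormalized incomplete Beta function against `s ^ (α - 1)`. -/
lemma integral_rpow_mul_incompleteBeta_sq {z w α r : ℝ} (hz : 0 < z) (hα : 0 < α)
    (hr : r ∈ Set.Ioo (0:ℝ) 1) :
    (∫ s in (0:ℝ)..r, s ^ (α - 1) * ∫ u in (0:ℝ)..s ^ 2, u ^ (z - 1) * (1 - u) ^ (w - 1))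
      = r ^ α / α * (∫ u in (0:ℝ)..r ^ 2, u ^ (z - 1) * (1 - u) ^ (w - 1))
        - 1 / α * ∫ u in (0:ℝ)..r ^ 2, u ^ (z + α / 2 - 1) * (1 - u) ^ (w - 1) := by
  have hz' : 0 < z + α / 2 := by positivity
  have hr2 : r ^ 2 ∈ Set.Ico (0:ℝ) 1 := ⟨by positivity, by nlinarith [hr.1, hr.2]⟩
  have hmaps : Set.MapsTo (fun s : ℝ => s ^ 2) (Set.Icc 0 r) (Set.Icc 0 (r ^ 2)) :=
    fun s hs => ⟨by positivity, pow_le_pow_left₀ hs.1 hs.2 2⟩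
  have hcont : ∀ y : ℝ, 0 < y → ContinuousOn
      (fun s : ℝ => ∫ u in (0:ℝ)..s ^ 2, u ^ (y - 1) * (1 - u) ^ (w - 1)) (Set.Icc 0 r) :=
    fun y hy => (continuousOn_integral_rpow_mul_one_sub_rpow hy hr2 w).comp
      (by fun_prop) hmaps
  have hderiv : ∀ y : ℝ, 0 < y → ∀ s ∈ Set.Ioo (0:ℝ) r, HasDerivAt
      (fun s : ℝ => ∫ u in (0:ℝ)..s ^ 2, u ^ (y - 1) * (1 - u) ^ (w - 1))
      ((s ^ 2) ^ (y - 1) * (1 - s ^ 2) ^ (w - 1) * (2 * s)) s := by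
    intro y hy s hs
    have hs2 : s ^ 2 ∈ Set.Ioo (0:ℝ) 1 :=
      ⟨pow_pos hs.1 2, by nlinarith [hs.1, hs.2, hr.2]⟩
    have hsq : HasDerivAt (fun s : ℝ => s ^ 2) (2 * s) s := by
      simpa using hasDerivAt_pow 2 s
    exact HasDerivAt.comp (h₂ := fun y' : ℝ => ∫ u in (0:ℝ)..y', u ^ (y - 1) * (1 - u) ^ (w - 1))
      s (hasDerivAt_integral_rpow_mul_one_sub_rpow hy hs2 w) hsq
  rw [intervalIntegral.integral_eq_sub_of_hasDerivAt_of_le hr.1.le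
    (f := fun s => s ^ α / α * (∫ u in (0:ℝ)..s ^ 2, u ^ (z - 1) * (1 - u) ^ (w - 1))
        - 1 / α * ∫ u in (0:ℝ)..s ^ 2, u ^ (z + α / 2 - 1) * (1 - u) ^ (w - 1))]
  · simp
  · have hpow : ContinuousOn (fun s : ℝ => s ^ α / α) (Set.Icc 0 r) :=
      ((continuous_id.rpow_const fun _ => Or.inr hα.le).div_const α).continuousOn
    exact (hpow.mul (hcont z hz)).sub (continuousOn_const.mul (hcont _ hz'))
  · intro s hs
    refine HasDerivAt.congr_deriv
      ((((Real.hasDerivAt_rpow_const (p := α) (Or.inl hs.1.ne')).div_const α).mul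
        (hderiv z hz s hs)).sub ((hderiv _ hz' s hs).const_mul (1 / α))) ?_
    have hsplit : (s ^ 2) ^ (z + α / 2 - 1) = (s ^ 2) ^ (z - 1) * s ^ α := by
      rw [show z + α / 2 - 1 = (z - 1) + α / 2 by ring, rpow_add (pow_pos hs.1 2),
        ← rpow_natCast s 2, ← rpow_mul hs.1.le _ (α / 2)]
      congr 2
      push_cast
      ring
    rw [hsplit]
    field_simp
    ring
  · refine (intervalIntegral.intervalIntegrable_rpow' (r := α - 1) (by linarith)).mul_continuousOn ?_
    rw [Set.uIcc_of_le hr.1.le]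
    exact hcont z hz

lemma betaFn_pos {z w : ℝ} (hz : 0 < z) (hw : 0 < w) : 0 < betaFn z w :=
  div_pos (mul_pos (Gamma_pos_of_pos hz) (Gamma_pos_of_pos hw)) (Gamma_pos_of_pos (add_pos hz hw))

theorem stmt8 (d : ℕ) (hd : 2 ≤ d) (α : ℝ) (hα : α ∈ Set.Ioo (0:ℝ) 2)
    (r : ℝ) (hr : r ∈ Set.Ioo (0:ℝ) 1) :
    (∫ s in (0:ℝ)..r, s ^ (α - 1) * regIncBeta (s^2) ((d:ℝ)/2 - α/2) (α/2))
      = r ^ α / α * regIncBeta (r^2) ((d:ℝ)/2 - α/2) (α/2)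
        - 1/α * (betaFn ((d:ℝ)/2) (α/2) / betaFn ((d:ℝ)/2 - α/2) (α/2))
            * regIncBeta (r^2) ((d:ℝ)/2) (α/2) := by
  have hd' : (2:ℝ) ≤ d := by exact_mod_cast hd
  have hz : 0 < (d:ℝ) / 2 - α / 2 := by linarith [hα.2]
  have hB := (betaFn_pos (show 0 < (d:ℝ) / 2 by linarith) (half_pos hα.1)).ne'
  have key := integral_rpow_mul_incompleteBeta_sq (w := α / 2) hz hα.1 hr
  rw [sub_add_cancel] at key
  simp only [regIncBeta, ← mul_div_assoc, intervalIntegral.integral_div, key]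
  field_simp
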